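/- Let ε ∈ (0,1) and δ ∈ (0, ε/33]. Let n be a positive integer, let L and R be disjoint nonempty subsets of [n], set l = |L| + |R| and γ = |L|/l, and set λ = 2δ and ζ = ε·δ·γ·(1−γ)/4. Assume λl is a positive integer that divides l, and let r = l/(λl). Let D ⊆ L × R be δ-regular between L and R. Let X and Y be disjoint subsets of [n] with |X| = |L| and |Y| = |R|, and let I_1, …, I_r be the natural partition of X ∪ Y into r intervals each of size λl. If (γλ − ζ)·l ≤ |X ∩ I_j| ≤ (γλ + ζ)·l for every j ∈ [r], then (X, Y) is safe for D, i.e., fit(τ, D) < ε·|L|·|R|/4 for every bijection τ : L ∪ R → X ∪ Y with τ(L) = X. -/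

import Mathlib

/-- Density of the pair `(A, B)` for a set of arcs `D`. -/
noncomputable def arcDensity {n : ℕ} (D : Finset (Fin n × Fin n))
    (A B : Finset (Fin n)) : ℝ :=
  ((D.filter fun p => p.1 ∈ A ∧ p.2 ∈ B).card : ℝ) / ((A.card : ℝ) * (B.card : ℝ))

/-- A set of arcs `D ⊆ L × R` is `δ`-regular between `L` and `R`. -/
def IsRegularArcs {n : ℕ} (δ : ℝ) (D : Finset (Fin n × Fin n))
    (L R : Finset (Fin n)) : Prop :=
  ∀ A ⊆ L, ∀ B ⊆ R, δ * (L.card : ℝ) < (A.card : ℝ) → δ * (R.card : ℝ) < (B.card : ℝ) →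
    |arcDensity D A B - arcDensity D L R| < δ

/-- `fit(τ, D)` for an (injective) map `τ`: pairs of `D` ordered correctly by `τ`
minus pairs ordered incorrectly. -/
def fitMap {n : ℕ} (τ : Fin n → Fin n) (D : Finset (Fin n × Fin n)) : ℤ :=
  ((D.filter fun p => τ p.1 < τ p.2).card : ℤ) - ((D.filter fun p => τ p.2 < τ p.1).card : ℤ)

/-- The `j`-th block (1-indexed) of the natural partition of `Z` into intervals of
size `k`: the elements of `Z` with ranks `(j-1)k+1, …, jk` in increasing order. -/
def block {n : ℕ} (Z : Finset (Fin n)) (k j : ℕ) : Finset (Fin n) :=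
  (((Z.sort (· ≤ ·)).drop ((j - 1) * k)).take k).toFinset

/-- The sign `1` for pairs in weakly increasing order and `-1` for the other pairs. -/
def orderSign (i j : ℕ) : ℝ := if i ≤ j then 1 else -1

/-- Nearly constant weights with constant sums have a small signed sum of products. -/
lemma sum_orderSign_mul_le (r : ℕ) (x y : ℕ → ℝ) (k m η M : ℝ) (hk : 0 ≤ k) (hη : 0 ≤ η)
    (hxy : ∀ i ∈ Finset.range r, x i + y i = k)
    (hx : ∀ i ∈ Finset.range r, |x i - m| ≤ η)
    (hM : ∀ i ∈ Finset.range r, x i * y i ≤ M) :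
    ∑ i ∈ Finset.range r, ∑ j ∈ Finset.range r, orderSign i j * (x i * y j)
      ≤ r ^ 2 * (k * η) + r * M := by
  set S := ∑ i ∈ Finset.range r, ∑ j ∈ Finset.range r, orderSign i j * (x i * y j) with hS
  have hswap : S = ∑ i ∈ Finset.range r, ∑ j ∈ Finset.range r, orderSign j i * (x j * y i) := by
    rw [hS, Finset.sum_comm]
  have hpair : ∀ i ∈ Finset.range r, ∀ j ∈ Finset.range r,
      orderSign i j * (x i * y j) + orderSign j i * (x j * y i)
        ≤ 2 * (k * η) + if i = j then 2 * M else 0 := by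
    intro i hi j hj
    have hyi : y i = k - x i := by linarith [hxy i hi]
    have hyj : y j = k - x j := by linarith [hxy j hj]
    obtain ⟨hi1, hi2⟩ := abs_le.mp (hx i hi)
    obtain ⟨hj1, hj2⟩ := abs_le.mp (hx j hj)
    have hkη := mul_nonneg hk hη
    rcases lt_trichotomy i j with h | h | h
    · simp only [orderSign, h.le, h.not_ge, h.ne, if_true, if_false]
      rw [hyi, hyj]
      nlinarith [mul_le_mul_of_nonneg_left (show x i - x j ≤ 2 * η by linarith) hk]
    · subst h
      simp only [orderSign, le_refl, if_true]
      linarith [hM i hi]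
    · simp only [orderSign, h.le, h.not_ge, h.ne', if_true, if_false]
      rw [hyi, hyj]
      nlinarith [mul_le_mul_of_nonneg_left (show x j - x i ≤ 2 * η by linarith) hk]
  have hsum := Finset.sum_le_sum fun i hi => Finset.sum_le_sum (hpair i hi)
  simp only [Finset.sum_add_distrib] at hsum
  rw [← hswap, ← hS] at hsum
  have hdiag : ∑ i ∈ Finset.range r, ∑ j ∈ Finset.range r, (if i = j then 2 * M else 0)
      = r * (2 * M) := by
    rw [Finset.sum_congr rfl fun i hi => by rw [Finset.sum_ite_eq, if_pos hi]]
    simp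
  rw [hdiag] at hsum
  simp only [Finset.sum_const, Finset.card_range, nsmul_eq_mul] at hsum
  nlinarith

/-- The zero-based index of the block of size `k` of the natural partition of `Z` containing `z`. -/
def blockIndex {n : ℕ} (Z : Finset (Fin n)) (k : ℕ) (z : Fin n) : ℕ :=
  (Z.sort (· ≤ ·)).idxOf z / k

lemma mem_block_succ_iff {n : ℕ} {Z : Finset (Fin n)} {k : ℕ} (hk : 0 < k) {z : Fin n} (i : ℕ) :
    z ∈ block Z k (i + 1) ↔ z ∈ Z ∧ blockIndex Z k z = i := by
  have hnd : (Z.sort (· ≤ ·)).Nodup := Z.sort_nodup _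
  simp only [block, Nat.add_sub_cancel, List.mem_toFinset, List.mem_take_iff_getElem,
    List.getElem_drop, List.length_drop, blockIndex]
  constructor
  · rintro ⟨t, ht, rfl⟩
    refine ⟨(Finset.mem_sort (· ≤ ·)).mp (List.getElem_mem _), ?_⟩
    rw [hnd.idxOf_getElem, mul_comm, Nat.mul_add_div hk, Nat.div_eq_of_lt (by omega), add_zero]
  · rintro ⟨hz, rfl⟩
    have hlt := List.idxOf_lt_length_of_mem ((Finset.mem_sort (· ≤ ·)).mpr hz)
    have hdm := Nat.div_add_mod' ((Z.sort (· ≤ ·)).idxOf z) k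
    have hmod := Nat.mod_lt ((Z.sort (· ≤ ·)).idxOf z) hk
    refine ⟨(Z.sort (· ≤ ·)).idxOf z % k, by omega, ?_⟩
    simp only [hdm, List.getElem_idxOf]

lemma blockIndex_lt {n : ℕ} {Z : Finset (Fin n)} {k r : ℕ} (hZ : Z.card = k * r)
    {z : Fin n} (hz : z ∈ Z) : blockIndex Z k z < r := by
  apply Nat.div_lt_of_lt_mul
  rw [← hZ, ← Finset.length_sort (· ≤ ·)]
  exact List.idxOf_lt_length_of_mem ((Finset.mem_sort (· ≤ ·)).mpr hz)

lemma blockIndex_mono {n : ℕ} {Z : Finset (Fin n)} (k : ℕ) {z w : Fin n}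
    (hz : z ∈ Z) (hw : w ∈ Z) (hzw : z < w) : blockIndex Z k z ≤ blockIndex Z k w := by
  apply Nat.div_le_div_right
  by_contra! h
  have hlz := List.idxOf_lt_length_of_mem ((Finset.mem_sort (· ≤ ·)).mpr hz)
  have hlw := List.idxOf_lt_length_of_mem ((Finset.mem_sort (· ≤ ·)).mpr hw)
  have := (Z.sortedLT_sort).getElem_lt_getElem_of_lt (hi := hlw) (hj := hlz) h
  simp only [List.getElem_idxOf] at this
  exact absurd this hzw.asymm

lemma card_block_succ {n : ℕ} {Z : Finset (Fin n)} {k r : ℕ} (hZ : Z.card = k * r)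
    {i : ℕ} (hi : i < r) : (block Z k (i + 1)).card = k := by
  have hnd : (Z.sort (· ≤ ·)).Nodup := Z.sort_nodup _
  rw [block, List.toFinset_card_of_nodup
    (hnd.sublist ((List.take_sublist _ _).trans (List.drop_sublist _ _)))]
  simp only [List.length_take, List.length_drop, Finset.length_sort, hZ, Nat.add_sub_cancel]
  have : k * (i + 1) ≤ k * r := Nat.mul_le_mul_left k hi
  apply min_eq_left
  rw [mul_comm i k]
  have : k * (i + 1) = k * i + k := by ring
  omega

/-- The part of `S` which `τ` maps into a given block has the size of the part of the image
lying in that block. -/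
lemma card_filter_blockIndex {n : ℕ} {S W Z : Finset (Fin n)} {k : ℕ} (hk : 0 < k)
    {τ : Fin n → Fin n} (hinj : Set.InjOn τ ↑S) (himg : S.image τ = W) (hWZ : W ⊆ Z) (i : ℕ) :
    (S.filter fun u => blockIndex Z k (τ u) = i).card = (W ∩ block Z k (i + 1)).card := by
  rw [← Finset.card_image_of_injOn (f := τ)
    (hinj.mono (Finset.coe_subset.mpr (Finset.filter_subset _ _)))]
  congr 1
  ext z
  simp only [Finset.mem_image, Finset.mem_filter, Finset.mem_inter, mem_block_succ_iff hk]
  constructor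
  · rintro ⟨u, ⟨hu, hi⟩, rfl⟩
    have : τ u ∈ W := himg ▸ Finset.mem_image_of_mem τ hu
    exact ⟨this, hWZ this, hi⟩
  · rintro ⟨hz, -, hi⟩
    rw [← himg, Finset.mem_image] at hz
    obtain ⟨u, hu, rfl⟩ := hz
    exact ⟨u, ⟨hu, hi⟩, rfl⟩

lemma fitMap_le_sum_orderSign {n : ℕ} (τ : Fin n → Fin n) (D : Finset (Fin n × Fin n))
    (c : Fin n → ℕ)
    (hc : ∀ p ∈ D, (τ p.1 < τ p.2 → c p.1 ≤ c p.2) ∧ (τ p.2 < τ p.1 → c p.2 ≤ c p.1))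
    (hne : ∀ p ∈ D, τ p.1 ≠ τ p.2) :
    (fitMap τ D : ℝ) ≤ ∑ p ∈ D, orderSign (c p.1) (c p.2) := by
  have : (fitMap τ D : ℝ) = ∑ p ∈ D,
      ((if τ p.1 < τ p.2 then (1 : ℝ) else 0) - if τ p.2 < τ p.1 then (1 : ℝ) else 0) := by
    simp [fitMap, Finset.sum_sub_distrib]
  rw [this]
  refine Finset.sum_le_sum fun p hp => ?_
  rcases lt_or_gt_of_ne (hne p hp) with h | h
  · simp [orderSign, h, h.not_gt, (hc p hp).1 h]
  · simp only [orderSign, h, h.not_gt, if_true, if_false]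
    split_ifs <;> norm_num

lemma arcDensity_le_one {n : ℕ} (D : Finset (Fin n × Fin n)) (A B : Finset (Fin n)) :
    arcDensity D A B ≤ 1 := by
  refine div_le_one_of_le₀ ?_ (by positivity)
  have : (D.filter fun p => p.1 ∈ A ∧ p.2 ∈ B) ⊆ A ×ˢ B := fun p hp =>
    Finset.mem_product.mpr (Finset.mem_filter.mp hp).2
  have := Finset.card_le_card this
  rw [Finset.card_product] at this
  exact_mod_cast this

lemma arcDensity_nonneg {n : ℕ} (D : Finset (Fin n × Fin n)) (A B : Finset (Fin n)) :
    0 ≤ arcDensity D A B := by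
  unfold arcDensity; positivity

/-- In a regular pair, signed arc counts between large sets are controlled by the density. -/
lemma IsRegularArcs.orderSign_mul_card_le {n : ℕ} {δ : ℝ} {D : Finset (Fin n × Fin n)}
    {L R A B : Finset (Fin n)} (hreg : IsRegularArcs δ D L R) (hδ : 0 < δ)
    (hAL : A ⊆ L) (hBR : B ⊆ R)
    (hA : δ * (L.card : ℝ) < A.card) (hB : δ * (R.card : ℝ) < B.card) (i j : ℕ) :
    orderSign i j * ((D.filter fun p => p.1 ∈ A ∧ p.2 ∈ B).card : ℝ)
      ≤ arcDensity D L R * (orderSign i j * (A.card * B.card)) + δ * (A.card * B.card) := by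
  have h := hreg A hAL B hBR hA hB
  have hA0 : (0 : ℝ) < A.card := lt_of_le_of_lt (by positivity) hA
  have hB0 : (0 : ℝ) < B.card := lt_of_le_of_lt (by positivity) hB
  have hAB := mul_pos hA0 hB0
  have he : ((D.filter fun p => p.1 ∈ A ∧ p.2 ∈ B).card : ℝ)
      = arcDensity D A B * (A.card * B.card) := by
    rw [arcDensity, div_mul_cancel₀ _ hAB.ne']
  rw [he]
  obtain ⟨h1, h2⟩ := abs_lt.mp h
  unfold orderSign
  split_ifs <;> nlinarith

/-- **Safety from balanced intersections (Lemma 3.5).**  If `D ⊆ L × R` is `δ`-regular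
and each block `I_j` of the natural partition of `X ∪ Y` into intervals of size `λl`
satisfies `|X ∩ I_j| = (γλ ± ζ)l`, then `(X, Y)` is safe for `D`:
`fit(τ, D) < ε|L||R|/4` for every bijection `τ : L ∪ R → X ∪ Y` with `τ(L) = X`. -/
theorem safe_of_balanced_blocks
    (ε δ : ℝ) (hε0 : 0 < ε) (hε1 : ε < 1) (hδ0 : 0 < δ) (hδε : δ ≤ ε / 33)
    (n : ℕ) (hn : 0 < n)
    (L R : Finset (Fin n)) (hLR : Disjoint L R) (hL : L.Nonempty) (hR : R.Nonempty)
    (l : ℕ) (hl : l = L.card + R.card)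
    (γ lam ζ : ℝ)
    (hγ : γ = (L.card : ℝ) / (l : ℝ))
    (hlam : lam = 2 * δ)
    (hζ : ζ = ε * δ * γ * (1 - γ) / 4)
    (k : ℕ) (hk : 0 < k) (hkval : (k : ℝ) = lam * (l : ℝ))
    (r : ℕ) (hkr : k * r = l)
    (D : Finset (Fin n × Fin n)) (hD : ∀ p ∈ D, p.1 ∈ L ∧ p.2 ∈ R)
    (hreg : IsRegularArcs δ D L R)
    (X Y : Finset (Fin n)) (hXY : Disjoint X Y)
    (hX : X.card = L.card) (hY : Y.card = R.card)
    (hbal : ∀ j ∈ Finset.Icc 1 r,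
      (γ * lam - ζ) * (l : ℝ) ≤ ((X ∩ block (X ∪ Y) k j).card : ℝ) ∧
      ((X ∩ block (X ∪ Y) k j).card : ℝ) ≤ (γ * lam + ζ) * (l : ℝ)) :
    ∀ τ : Fin n → Fin n, Set.InjOn τ ↑(L ∪ R) →
      (L ∪ R).image τ = X ∪ Y → L.image τ = X →
      (fitMap τ D : ℝ) < ε * (L.card : ℝ) * (R.card : ℝ) / 4 := by
  intro τ hinj himg himgL
  have hinjL : Set.InjOn τ ↑L := hinj.mono (by simp)
  have hinjR : Set.InjOn τ ↑R := hinj.mono (by simp)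
  have himgR : R.image τ = Y := by
    refine Finset.eq_of_subset_of_card_le (fun z hz => ?_)
      (by rw [Finset.card_image_of_injOn hinjR, hY])
    obtain ⟨v, hv, rfl⟩ := Finset.mem_image.mp hz
    have hmem : τ v ∈ X ∪ Y :=
      himg ▸ Finset.mem_image_of_mem τ (Finset.mem_union_right L hv)
    refine (Finset.mem_union.mp hmem).resolve_left fun hvX => ?_
    rw [← himgL, Finset.mem_image] at hvX
    obtain ⟨u, hu, huv⟩ := hvX
    have := hinj (by simp [hu]) (by simp [hv]) huv
    exact Finset.disjoint_left.mp hLR hu (this ▸ hv)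
  have hZ : (X ∪ Y).card = k * r := by
    rw [Finset.card_union_of_disjoint hXY, hX, hY, hkr, hl]
  set c : Fin n → ℕ := fun u => blockIndex (X ∪ Y) k (τ u) with hc
  have hmemL : ∀ u ∈ L, τ u ∈ X ∪ Y := fun u hu =>
    himg ▸ Finset.mem_image_of_mem τ (Finset.mem_union_left R hu)
  have hmemR : ∀ u ∈ R, τ u ∈ X ∪ Y := fun u hu =>
    himg ▸ Finset.mem_image_of_mem τ (Finset.mem_union_right L hu)
  have hcL : ∀ u ∈ L, c u ∈ Finset.range r := fun u hu =>
    Finset.mem_range.mpr (blockIndex_lt hZ (hmemL u hu))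
  have hcR : ∀ u ∈ R, c u ∈ Finset.range r := fun u hu =>
    Finset.mem_range.mpr (blockIndex_lt hZ (hmemR u hu))
  set A : ℕ → Finset (Fin n) := fun i => L.filter fun u => c u = i with hAdef
  set B : ℕ → Finset (Fin n) := fun i => R.filter fun u => c u = i with hBdef
  have hA : ∀ i, (A i).card = (X ∩ block (X ∪ Y) k (i + 1)).card :=
    card_filter_blockIndex hk hinjL himgL Finset.subset_union_left
  have hB : ∀ i, (B i).card = (Y ∩ block (X ∪ Y) k (i + 1)).card :=
    card_filter_blockIndex hk hinjR himgR Finset.subset_union_right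
  have hsumA : ∑ i ∈ Finset.range r, ((A i).card : ℝ) = L.card := by
    exact_mod_cast (Finset.card_eq_sum_card_fiberwise (f := c) hcL).symm
  have hsumB : ∑ i ∈ Finset.range r, ((B i).card : ℝ) = R.card := by
    exact_mod_cast (Finset.card_eq_sum_card_fiberwise (f := c) hcR).symm
  have hAB : ∀ i ∈ Finset.range r, ((A i).card : ℝ) + (B i).card = k := by
    intro i hi
    have hsub : block (X ∪ Y) k (i + 1) ⊆ X ∪ Y := fun z hz =>
      ((mem_block_succ_iff hk i).mp hz).1
    have hcard := card_block_succ hZ (Finset.mem_range.mp hi)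
    rw [← Finset.inter_eq_right.mpr hsub, Finset.union_inter_distrib_right,
      Finset.card_union_of_disjoint
        (hXY.mono Finset.inter_subset_left Finset.inter_subset_left), ← hA, ← hB] at hcard
    exact_mod_cast hcard
  have ha : (0 : ℝ) < L.card := by exact_mod_cast hL.card_pos
  have hb : (0 : ℝ) < R.card := by exact_mod_cast hR.card_pos
  have hlab : (l : ℝ) = L.card + R.card := by exact_mod_cast hl
  have hkr' : (k : ℝ) * r = l := by exact_mod_cast hkr
  set a : ℝ := (L.card : ℝ)
  set b : ℝ := (R.card : ℝ)
  have hl0 : (0 : ℝ) < l := by linarith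
  have hr : (r : ℝ) * (2 * δ) = 1 := by
    rw [hkval, hlam] at hkr'
    exact mul_right_cancel₀ hl0.ne' (by linarith)
  have hγl : γ * l = a := by rw [hγ, div_mul_cancel₀ _ hl0.ne']
  have hγ' : 1 - γ = b / l := by
    rw [hγ, hlab]
    field_simp
    ring
  set η : ℝ := ζ * l with hη
  have hη1 : η * l = ε * δ * a * b / 4 := by
    rw [hη, hζ, hγ', hγ]
    field_simp
  have hη0 : 0 < η := pos_of_mul_pos_left (by rw [hη1]; positivity) hl0.le
  have hηa : η ≤ δ * a / 4 := by
    refine le_of_mul_le_mul_right ?_ hl0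
    rw [hη1]
    have h1 : ε * (δ * a * b) ≤ 1 * (δ * a * b) := by gcongr
    have h2 : δ * a * b ≤ δ * a * l := by gcongr; linarith
    linarith
  have hηb : η ≤ δ * b / 4 := by
    refine le_of_mul_le_mul_right ?_ hl0
    rw [hη1]
    have h1 : ε * (δ * a * b) ≤ 1 * (δ * a * b) := by gcongr
    have h2 : δ * b * a ≤ δ * b * l := by gcongr; linarith
    linarith
  have hx : ∀ i ∈ Finset.range r, |((A i).card : ℝ) - 2 * δ * a| ≤ η := by
    intro i hi
    have hbi := hbal (i + 1)
      (Finset.mem_Icc.mpr ⟨by omega, Finset.mem_range.mp hi⟩)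
    rw [← hA] at hbi
    have hm : γ * lam * l = 2 * δ * a := by rw [← hγl, hlam]; ring
    rw [sub_mul, add_mul, hm] at hbi
    exact abs_le.mpr ⟨by linarith [hbi.1], by linarith [hbi.2]⟩
  have hk' : (k : ℝ) = 2 * δ * a + 2 * δ * b := by rw [hkval, hlam, hlab]; ring
  have hδa := mul_pos hδ0 ha
  have hδb := mul_pos hδ0 hb
  have hAl : ∀ i ∈ Finset.range r, δ * a < (A i).card := fun i hi => by
    linarith [(abs_le.mp (hx i hi)).1]
  have hBl : ∀ i ∈ Finset.range r, δ * b < (B i).card := fun i hi => by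
    linarith [(abs_le.mp (hx i hi)).2, hAB i hi]
  have hM : ∀ i ∈ Finset.range r,
      ((A i).card : ℝ) * (B i).card ≤ (9 / 4 * (δ * a)) * (9 / 4 * (δ * b)) := by
    intro i hi
    have h1 := abs_le.mp (hx i hi)
    have h2 := hAB i hi
    apply mul_le_mul <;> first | positivity | linarith
  have hS := sum_orderSign_mul_le r (fun i => ((A i).card : ℝ)) (fun i => ((B i).card : ℝ))
    k (2 * δ * a) η _ (by positivity) hη0.le hAB hx hM
  have hfib : ∑ p ∈ D, orderSign (c p.1) (c p.2) =
      ∑ i ∈ Finset.range r, ∑ j ∈ Finset.range r,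
        orderSign i j * ((D.filter fun p => p.1 ∈ A i ∧ p.2 ∈ B j).card : ℝ) := by
    rw [← Finset.sum_product', ← Finset.sum_fiberwise_of_maps_to (s := D)
      (t := Finset.range r ×ˢ Finset.range r) (g := fun p => (c p.1, c p.2))
      fun p hp => Finset.mem_product.mpr ⟨hcL _ (hD p hp).1, hcR _ (hD p hp).2⟩]
    refine Finset.sum_congr rfl fun q _ => ?_
    have hfil : (D.filter fun p => (c p.1, c p.2) = q)
        = D.filter fun p => p.1 ∈ A q.1 ∧ p.2 ∈ B q.2 := by
      refine Finset.filter_congr fun p hp => ?_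
      simp [hAdef, hBdef, hD p hp, Prod.ext_iff]
    rw [← hfil, Finset.sum_congr rfl (g := fun _ => orderSign q.1 q.2), Finset.sum_const,
      nsmul_eq_mul, mul_comm]
    rintro p hp
    rw [← (Finset.mem_filter.mp hp).2]
  have hfit : (fitMap τ D : ℝ) ≤ ∑ p ∈ D, orderSign (c p.1) (c p.2) := by
    refine fitMap_le_sum_orderSign τ D c (fun p hp => ?_) fun p hp h => ?_
    · have h1 := hmemL _ (hD p hp).1
      have h2 := hmemR _ (hD p hp).2
      exact ⟨blockIndex_mono k h1 h2, blockIndex_mono k h2 h1⟩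
    · have := hinj (by simp [(hD p hp).1]) (by simp [(hD p hp).2]) h
      exact Finset.disjoint_left.mp hLR (hD p hp).1 (this ▸ (hD p hp).2)
  have hterm := Finset.sum_le_sum fun i (hi : i ∈ Finset.range r) =>
    Finset.sum_le_sum fun j (hj : j ∈ Finset.range r) =>
      hreg.orderSign_mul_card_le hδ0 (Finset.filter_subset _ L : A i ⊆ L)
        (Finset.filter_subset _ R : B j ⊆ R) (hAl i hi) (hBl j hj) i j
  simp only [Finset.sum_add_distrib, ← Finset.mul_sum] at hterm
  rw [← Finset.sum_mul, hsumA, hsumB] at hterm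
  have hbound : (r : ℝ) ^ 2 * (k * η) + r * ((9 / 4 * (δ * a)) * (9 / 4 * (δ * b)))
      = ε * (a * b) / 8 + 81 / 32 * (δ * (a * b)) := by
    have h1 : (r : ℝ) ^ 2 * (k * η) = r * (η * l) := by rw [← hkr']; ring
    rw [h1, hη1]
    linear_combination (ε * a * b / 8 + 81 / 32 * δ * a * b) * hr
  rw [hbound] at hS
  have hab := mul_pos ha hb
  have hd0 := arcDensity_nonneg D L R
  have hd1 := arcDensity_le_one D L R
  have hpos : 0 ≤ ε * (a * b) / 8 + 81 / 32 * (δ * (a * b)) := by positivity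
  have hdS := (mul_le_mul_of_nonneg_left hS hd0).trans (mul_le_of_le_one_left hpos hd1)
  have hδab : δ * (a * b) ≤ ε / 33 * (a * b) := by gcongr
  have hεab := mul_pos hε0 hab
  linarith
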